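/- Let n ≥ 1 be a natural number, let ε ∈ (0,1) be a real number, let F be an n×n real symmetric positive semidefinite matrix with λ_max(F) > 0, and define g(x) := (ε·x/n)·Tr((x·I − F)^{-1}) for x > λ_max(F). Set δ := ε³/(32n). If θ* > λ_max(F) satisfies g(θ*) = 1 and θ satisfies θ* ≤ θ < (1+δ)·θ*, then 1 − ε < g(θ) ≤ 1. -/

import Mathlib

theorem trace_resolvent_aux {n : ℕ} (F : Matrix (Fin n) (Fin n) ℝ) (hF : F.IsHermitian) (x : ℝ)
    (hx : ∀ i, hF.eigenvalues i < x) :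
    ((x • (1 : Matrix (Fin n) (Fin n) ℝ) - F)⁻¹).trace = ∑ i, (x - hF.eigenvalues i)⁻¹ := by
  obtain ⟨U, V, hUV, hVU, hs⟩ : ∃ U V : Matrix (Fin n) (Fin n) ℝ, U * V = 1 ∧ V * U = 1 ∧
      F = U * Matrix.diagonal hF.eigenvalues * V := by
    refine ⟨hF.eigenvectorUnitary, star (hF.eigenvectorUnitary : Matrix (Fin n) (Fin n) ℝ),
      Unitary.coe_mul_star_self _, Unitary.coe_star_mul_self _, ?_⟩
    have h := hF.spectral_theorem
    rw [Unitary.conjStarAlgAut_apply] at h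
    exact h
  have h1 : x • (1 : Matrix (Fin n) (Fin n) ℝ) - F =
      U * Matrix.diagonal (fun i => x - hF.eigenvalues i) * V := by
    have h2 : Matrix.diagonal (fun i => x - hF.eigenvalues i) =
        x • (1 : Matrix (Fin n) (Fin n) ℝ) - Matrix.diagonal hF.eigenvalues := by
      rw [← Matrix.diagonal_one, ← Matrix.diagonal_smul, Matrix.diagonal_sub]
      simp
    rw [h2, mul_sub, sub_mul, ← hs]
    simp [hUV]
  have h3 : (x • (1 : Matrix (Fin n) (Fin n) ℝ) - F)⁻¹ =
      U * Matrix.diagonal (fun i => (x - hF.eigenvalues i)⁻¹) * V := by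
    apply Matrix.inv_eq_right_inv
    rw [h1]
    calc _ = U * Matrix.diagonal (fun i => x - hF.eigenvalues i) * (V * U) *
          Matrix.diagonal (fun i => (x - hF.eigenvalues i)⁻¹) * V := by
            simp only [Matrix.mul_assoc]
      _ = U * (Matrix.diagonal (fun i => x - hF.eigenvalues i) *
          Matrix.diagonal (fun i => (x - hF.eigenvalues i)⁻¹)) * V := by
            rw [hVU, Matrix.mul_one, Matrix.mul_assoc U]
      _ = 1 := by
        have : (fun i => (x - hF.eigenvalues i) * (x - hF.eigenvalues i)⁻¹) = fun _ => 1 := by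
          funext i
          exact mul_inv_cancel₀ (sub_pos.2 (hx i)).ne'
        rw [Matrix.diagonal_mul_diagonal, this, Matrix.diagonal_one, Matrix.mul_one, hUV]
  rw [h3, Matrix.trace_mul_comm, ← Matrix.mul_assoc, hVU, Matrix.one_mul, Matrix.trace_diagonal]

/-- With `δ = ε³/(32n)`, if `g(θ*) = 1` for `θ* > λ_max(F)` and
`θ* ≤ θ < (1+δ)·θ*`, then `1 - ε < g(θ) ≤ 1`. -/
theorem g_theta_approx_cover
    {n : ℕ} (hn : 1 ≤ n) (ε : ℝ) (hε : ε ∈ Set.Ioo (0 : ℝ) 1)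
    (F : Matrix (Fin n) (Fin n) ℝ) (hF : F.PosSemidef)
    (lam : ℝ) (hlam : lam = ⨆ i, hF.1.eigenvalues i) (hlampos : 0 < lam)
    (g : ℝ → ℝ)
    (hg : ∀ x : ℝ,
      g x = (ε * x / (n : ℝ)) * ((x • (1 : Matrix (Fin n) (Fin n) ℝ) - F)⁻¹).trace)
    (δ : ℝ) (hδ : δ = ε ^ 3 / (32 * (n : ℝ)))
    (θs θ : ℝ) (hθs : lam < θs) (hgθs : g θs = 1)
    (hlow : θs ≤ θ) (hupp : θ < (1 + δ) * θs) :
    1 - ε < g θ ∧ g θ ≤ 1 := by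
  obtain ⟨h0, h1⟩ := hε
  have hn0 : (0 : ℝ) < n := by exact_mod_cast hn
  have hle : ∀ i, hF.1.eigenvalues i ≤ lam := fun i => by
    rw [hlam]
    exact le_ciSup (Set.finite_range _).bddAbove i
  have hnn : ∀ i, 0 ≤ hF.1.eigenvalues i := hF.eigenvalues_nonneg
  have hG : ∀ x, lam < x → g x = ∑ i, ε / n * (x / (x - hF.1.eigenvalues i)) := by
    intro x hx
    rw [hg, trace_resolvent_aux F hF.1 x (fun i => (hle i).trans_lt hx), Finset.mul_sum]
    refine Finset.sum_congr rfl fun i _ => ?_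
    ring
  have hs0 : 0 < θs := hlampos.trans hθs
  have hcn : 0 < ε / n := by positivity
  rw [hG θs hθs] at hgθs
  rw [hG θ (hθs.trans_le hlow)]
  have hpos : ∀ i, 0 < θs - hF.1.eigenvalues i := fun i => by linarith [hle i]
  have hpos' : ∀ i, 0 < θ - hF.1.eigenvalues i := fun i => by linarith [hle i]
  constructor
  · have hterm : ∀ i, ε * θs ≤ n * (θs - hF.1.eigenvalues i) := by
      intro i
      have h := Finset.single_le_sum (f := fun i => ε / n * (θs / (θs - hF.1.eigenvalues i)))
        (fun j _ => mul_nonneg hcn.le (div_nonneg hs0.le (hpos j).le)) (Finset.mem_univ i)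
      rw [hgθs] at h
      rw [div_mul_div_comm, div_le_one (mul_pos hn0 (hpos i))] at h
      exact h
    have hδθ : ∀ i, δ * θs ≤ ε ^ 2 / 32 * (θs - hF.1.eigenvalues i) := by
      intro i
      have : δ * θs = ε ^ 2 / (32 * n) * (ε * θs) := by rw [hδ]; ring
      rw [this]
      calc _ ≤ ε ^ 2 / (32 * n) * (n * (θs - hF.1.eigenvalues i)) := by
            exact mul_le_mul_of_nonneg_left (hterm i) (by positivity)
        _ = _ := by field_simp
    have hc : (1 - ε) * (1 + ε ^ 2 / 32) < 1 := by nlinarith [mul_pos h0 h0, pow_pos h0 3]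
    have hc0 : 0 < 1 + ε ^ 2 / 32 := by positivity
    have hc' : 1 - ε < (1 + ε ^ 2 / 32)⁻¹ := by
      rw [← one_div, lt_div_iff₀ hc0]; exact hc
    refine hc'.trans_le ?_
    generalize hk : 1 + ε ^ 2 / 32 = k
    rw [← mul_one (k⁻¹), ← hgθs, Finset.mul_sum]
    refine Finset.sum_le_sum fun i _ => ?_
    rw [mul_left_comm]
    refine mul_le_mul_of_nonneg_left ?_ hcn.le
    rw [← div_eq_inv_mul, div_div]
    refine div_le_div₀ (hs0.le.trans hlow) hlow (hpos' i) ?_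
    rw [← hk]
    nlinarith [hδθ i]
  · rw [← hgθs]
    refine Finset.sum_le_sum fun i _ => mul_le_mul_of_nonneg_left ?_ hcn.le
    rw [div_le_div_iff₀ (hpos' i) (hpos i)]
    nlinarith [mul_le_mul_of_nonneg_right hlow (hnn i)]
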